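/- arXiv:1502.02144 — 4 statements merged into one kernel-verified Lean document; each statement's English description precedes it below -/
import Mathlib

section
/- (Decomposition (A6), Appendix) Let s be a complex number with Re(s) > 1 and let N ≥ 1 be a natural number. Then ζ(s) = Σ_{n=1}^{N} n^{−s} + ∫_{N+1/2}^{∞} x^{−s} dx + Σ_{m=1}^{∞} ∫_{N+m−1/2}^{N+m+1/2} ((N+m)^{−s} − x^{−s}) dx, where the infinite series of integrals converges. -/
open Complex MeasureTheory

/-- An integral over a half-line is the sum of the integrals over consecutive unit intervals. -/
lemma hasSum_intervalIntegral_unit {f : ℝ → ℂ} {a : ℝ} (hf : IntegrableOn f (Set.Ioi a)) :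
    HasSum (fun m : ℕ => ∫ x in (a + m)..(a + (m + 1 : ℕ)), f x) (∫ x in Set.Ioi a, f x) := by
  have hmono : Monotone (fun m : ℕ => a + (m : ℝ)) := fun i j hij => by
    simpa using hij
  have hU : ⋃ m : ℕ, Set.Ioc (a + (m : ℝ)) (a + (m + 1 : ℕ)) = Set.Ioi a := by
    have h := iUnion_Ioc_map_succ_eq_Ioi (f := fun m : ℕ => a + (m : ℝ))
      (fun m => hmono (Nat.zero_le m))
      (Filter.not_bddAbove_of_tendsto_atTop
        (Filter.tendsto_atTop_add_const_left _ a tendsto_natCast_atTop_atTop))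
    simpa using h
  have h := hasSum_integral_iUnion (μ := volume) (f := f)
    (s := fun m : ℕ => Set.Ioc (a + (m : ℝ)) (a + (m + 1 : ℕ)))
    (fun _ => measurableSet_Ioc) hmono.pairwise_disjoint_on_Ioc_succ (by rwa [hU])
  rw [hU] at h
  refine h.congr_fun fun m => ?_
  exact intervalIntegral.integral_of_le (hmono (Nat.le_succ m))

/-- (Decomposition (A6), Appendix) For `Re s > 1` and `N ≥ 1`,
`ζ(s) = Σ_{n=1}^{N} n^{-s} + ∫_{N+1/2}^{∞} x^{-s} dx +
 Σ_{m=1}^{∞} ∫_{N+m-1/2}^{N+m+1/2} ((N+m)^{-s} - x^{-s}) dx`,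
where the series of integrals converges. -/
theorem euler_mclaurin_decomposition (s : ℂ) (hs : 1 < s.re) (N : ℕ) (hN : 1 ≤ N) :
    Summable (fun m : ℕ =>
      ∫ x in ((N : ℝ) + (m + 1) - 1 / 2)..((N : ℝ) + (m + 1) + 1 / 2),
        (((N + m + 1 : ℕ) : ℂ) ^ (-s) - (x : ℂ) ^ (-s))) ∧
    riemannZeta s =
      (∑ n ∈ Finset.Icc 1 N, (n : ℂ) ^ (-s)) +
      (∫ x in Set.Ioi ((N : ℝ) + 1 / 2), (x : ℂ) ^ (-s)) +
      ∑' m : ℕ,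
        ∫ x in ((N : ℝ) + (m + 1) - 1 / 2)..((N : ℝ) + (m + 1) + 1 / 2),
          (((N + m + 1 : ℕ) : ℂ) ^ (-s) - (x : ℂ) ^ (-s)) := by
  have ha : (0 : ℝ) < (N : ℝ) + 1 / 2 := by positivity
  have hint : IntegrableOn (fun x : ℝ => (x : ℂ) ^ (-s)) (Set.Ioi ((N : ℝ) + 1 / 2)) :=
    integrableOn_Ioi_cpow_of_lt (by simpa using hs) ha
  have hI := hasSum_intervalIntegral_unit hint
  have hZ : HasSum (fun n : ℕ => ((n + 1 : ℕ) : ℂ) ^ (-s)) (riemannZeta s) := by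
    have hsum : Summable (fun n : ℕ => 1 / ((n : ℂ) + 1) ^ s) := by
      simpa using (summable_nat_add_iff 1).mpr (Complex.summable_one_div_nat_cpow.mpr hs)
    rw [zeta_eq_tsum_one_div_nat_add_one_cpow hs]
    refine hsum.hasSum.congr_fun fun n => ?_
    rw [cpow_neg, one_div, Nat.cast_add_one]
  have hT : HasSum (fun m : ℕ => ((N + m + 1 : ℕ) : ℂ) ^ (-s))
      (riemannZeta s - ∑ n ∈ Finset.Icc 1 N, (n : ℂ) ^ (-s)) := by
    have h := (hasSum_nat_add_iff' N).mpr hZ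
    rw [Finset.range_eq_Ico, Finset.sum_Ico_add' (fun n : ℕ => (n : ℂ) ^ (-s)) 0 N 1] at h
    have hIcc : Finset.Ico (0 + 1) (N + 1) = Finset.Icc 1 N := by
      ext n
      simp
    rw [hIcc] at h
    simpa only [Nat.add_comm _ N] using h
  have hD : HasSum (fun m : ℕ =>
      ∫ x in ((N : ℝ) + (m + 1) - 1 / 2)..((N : ℝ) + (m + 1) + 1 / 2),
        (((N + m + 1 : ℕ) : ℂ) ^ (-s) - (x : ℂ) ^ (-s)))
      (riemannZeta s - ∑ n ∈ Finset.Icc 1 N, (n : ℂ) ^ (-s) -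
        ∫ x in Set.Ioi ((N : ℝ) + 1 / 2), (x : ℂ) ^ (-s)) := by
    refine (hT.sub hI).congr_fun fun m => ?_
    have e1 : (N : ℝ) + (m + 1) - 1 / 2 = N + 1 / 2 + m := by ring
    have e2 : (N : ℝ) + (m + 1) + 1 / 2 = N + 1 / 2 + (m + 1 : ℕ) := by push_cast; ring
    have hle : (N : ℝ) + 1 / 2 + m ≤ N + 1 / 2 + (m + 1 : ℕ) := by simp
    rw [e1, e2, intervalIntegral.integral_sub intervalIntegrable_const
      ((intervalIntegrable_iff_integrableOn_Ioc_of_le hle).mpr (hint.mono_set ?_))]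
    · simp
    · exact fun x hx => lt_of_le_of_lt (by simp) hx.1
  refine ⟨hD.summable, ?_⟩
  rw [hD.tsum_eq]
  ring
end

section
/- (Series expansion (A7)–(A8), Appendix) Let x > 1/2 be a real number and s a complex number. Then ∫_{−1/2}^{1/2} (x^{−s} − (x+η)^{−s}) dη = − Σ_{k=0}^{∞} [ s·(s+1)·(s+2)⋯(s+2k+1) ] · x^{−s−2k−2} / (2^{2k+2} · (2k+3)!), i.e. the integral equals minus the sum over k ≥ 0 of ∏_{j=0}^{2k+1}(s+j) · x^{−s−2k−2} / (2^{2k+2}·(2k+3)!), and this series converges. (Only the even-order Taylor terms contribute, the integrals of the odd powers of η vanishing.) -/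
open Complex MeasureTheory Finset

theorem Complex.choose_add_sub_one_eq_prod_div_factorial (s : ℂ) (n : ℕ) :
    Ring.choose (s + n - 1) n = (∏ j ∈ Finset.range n, (s + (j : ℂ))) / (n.factorial : ℂ) := by
  rw [← Ring.multichoose_eq, eq_div_iff (by exact_mod_cast n.factorial_ne_zero), mul_comm,
    ← nsmul_eq_mul, Ring.factorial_nsmul_multichoose_eq_ascPochhammer]
  induction n with
  | zero => simp
  | succ n ih =>
    rw [ascPochhammer_succ_right, Polynomial.smeval_mul, ih, Finset.prod_range_succ]
    simp [Polynomial.smeval_add, Polynomial.smeval_natCast]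

/-- The binomial series of `(1 - z) ^ (-s)`. -/
theorem Complex.hasSum_one_sub_cpow_neg (s : ℂ) {z : ℂ} (hz : ‖z‖ < 1) :
    HasSum (fun n : ℕ => (∏ j ∈ Finset.range n, (s + (j : ℂ))) / (n.factorial : ℂ) * z ^ n)
      ((1 - z) ^ (-s)) := by
  have h := (one_div_one_sub_cpow_hasFPowerSeriesOnBall_zero s).hasSum
    (y := z) (by simpa [← ENNReal.ofReal_one, Metric.eball_ofReal] using hz)
  simpa [choose_add_sub_one_eq_prod_div_factorial, FormalMultilinearSeries.ofScalars,
    cpow_neg, mul_comm] using h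

theorem intervalIntegral.integral_ofReal_pow (a b : ℝ) (n : ℕ) :
    ∫ t in a..b, (t : ℂ) ^ n = ((b : ℂ) ^ (n + 1) - (a : ℂ) ^ (n + 1)) / (n + 1) := by
  have h : ∫ t in a..b, ((t ^ n : ℝ) : ℂ) = ((∫ t in a..b, t ^ n : ℝ) : ℂ) :=
    intervalIntegral.integral_ofReal
  rw [integral_pow] at h
  push_cast at h
  exact h

/-- Termwise integration of the binomial series of `(x + t) ^ (-s)` in powers of `t / x`. -/
theorem Complex.hasSum_integral_add_cpow_neg {x a : ℝ} (ha : 0 ≤ a) (hx : a < x) (s : ℂ) :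
    HasSum (fun n : ℕ => (∏ j ∈ Finset.range n, (s + (j : ℂ))) / (n.factorial : ℂ) *
        (-(x : ℂ)⁻¹) ^ n * (x : ℂ) ^ (-s) * ∫ t in -a..a, (t : ℂ) ^ n)
      (∫ t in -a..a, ((x + t : ℝ) : ℂ) ^ (-s)) := by
  have hx0 : 0 < x := ha.trans_lt hx
  have hax : a / x < 1 := (div_lt_one hx0).2 hx
  have habs {t : ℝ} (ht : t ∈ Set.uIoc (-a) a) : |t| ≤ a := by
    rw [Set.uIoc_of_le (by linarith)] at ht
    exact abs_le.2 ⟨ht.1.le, ht.2⟩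
  have hsummable := (hasSum_one_sub_cpow_neg s (z := ((a / x : ℝ) : ℂ))
    (by rwa [norm_real, Real.norm_of_nonneg (by positivity)])).summable.norm.mul_right
      ‖(x : ℂ) ^ (-s)‖
  simp_rw [← intervalIntegral.integral_const_mul]
  refine intervalIntegral.hasSum_integral_of_dominated_convergence
    (fun n _ => ‖(∏ j ∈ Finset.range n, (s + (j : ℂ))) / (n.factorial : ℂ) *
      ((a / x : ℝ) : ℂ) ^ n‖ * ‖(x : ℂ) ^ (-s)‖)
    (fun n => (by fun_prop : Continuous _).aestronglyMeasurable)
    (fun n => .of_forall fun t ht => ?_) (.of_forall fun _ _ => hsummable)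
    intervalIntegrable_const (.of_forall fun t ht => ?_)
  · have htx : ‖(-(x : ℂ)⁻¹) ^ n * (t : ℂ) ^ n‖ ≤ ‖((a / x : ℝ) : ℂ) ^ n‖ := by
      rw [← mul_pow, norm_pow, norm_pow, norm_real, Real.norm_of_nonneg (by positivity)]
      gcongr
      rw [norm_mul, norm_neg, norm_inv, norm_real, norm_real, Real.norm_of_nonneg hx0.le,
        Real.norm_eq_abs, div_eq_inv_mul]
      gcongr
      exact habs ht
    calc
      _ = ‖(∏ j ∈ Finset.range n, (s + (j : ℂ))) / (n.factorial : ℂ)‖ *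
          ‖(-(x : ℂ)⁻¹) ^ n * (t : ℂ) ^ n‖ * ‖(x : ℂ) ^ (-s)‖ := by
        simp only [norm_mul]
        ring
      _ ≤ _ := by
        rw [norm_mul _ (((a / x : ℝ) : ℂ) ^ n)]
        gcongr
  · have htx : |t / x| < 1 := by
      rw [abs_div, abs_of_pos hx0]
      exact (div_le_div_of_nonneg_right (habs ht) hx0.le).trans_lt hax
    have h := (hasSum_one_sub_cpow_neg s (z := ((-(t / x) : ℝ) : ℂ))
      (by rwa [norm_real, norm_neg])).mul_left ((x : ℂ) ^ (-s))
    have hfactor : ((x + t : ℝ) : ℂ) ^ (-s) =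
        (x : ℂ) ^ (-s) * (1 - ((-(t / x) : ℝ) : ℂ)) ^ (-s) := by
      have h1 : (1 : ℂ) - ((-(t / x) : ℝ) : ℂ) = ((1 + t / x : ℝ) : ℂ) := by push_cast; ring
      rw [h1, ← mul_cpow_ofReal_nonneg hx0.le (by linarith [(abs_lt.1 htx).1]), ← ofReal_mul,
        mul_add, mul_one, mul_div_cancel₀ _ hx0.ne']
    rw [hfactor]
    refine h.congr_fun fun n => ?_
    push_cast
    rw [show -((t : ℂ) / x) = -(x : ℂ)⁻¹ * t by ring, mul_pow]
    ring

/-- (Series expansion (A7)–(A8), Appendix) For real `x > 1/2` and complex `s`,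
`∫_{-1/2}^{1/2} (x^{-s} - (x+η)^{-s}) dη
  = - Σ_{k=0}^{∞} (∏_{j=0}^{2k+1} (s+j)) · x^{-s-2k-2} / (2^{2k+2} (2k+3)!)`,
and the series converges. -/
theorem taylor_even_terms (x : ℝ) (hx : 1 / 2 < x) (s : ℂ) :
    Summable (fun k : ℕ =>
      (∏ j ∈ Finset.range (2 * k + 2), (s + (j : ℂ))) *
        (x : ℂ) ^ (-s - 2 * k - 2) /
        (2 ^ (2 * k + 2) * (Nat.factorial (2 * k + 3) : ℂ))) ∧
    (∫ η in (-(1 / 2) : ℝ)..(1 / 2), ((x : ℂ) ^ (-s) - ((x + η : ℝ) : ℂ) ^ (-s))) =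
      - ∑' k : ℕ,
        (∏ j ∈ Finset.range (2 * k + 2), (s + (j : ℂ))) *
          (x : ℂ) ^ (-s - 2 * k - 2) /
          (2 ^ (2 * k + 2) * (Nat.factorial (2 * k + 3) : ℂ)) := by
  have hx0 : 0 < x := by linarith
  have hxC : (x : ℂ) ≠ 0 := by exact_mod_cast hx0.ne'
  have hall := hasSum_integral_add_cpow_neg (by norm_num : (0 : ℝ) ≤ 1 / 2) hx s
  rw [← (mul_right_injective₀ (two_ne_zero (α := ℕ))).hasSum_iff, ← hasSum_nat_add_iff' 1] at hall
  · have heven (m : ℕ) : ∫ t in (-(1 / 2) : ℝ)..(1 / 2), (t : ℂ) ^ (2 * m) =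
        1 / (2 ^ (2 * m) * (2 * m + 1)) := by
      rw [intervalIntegral.integral_ofReal_pow]
      push_cast
      rw [(even_two_mul m).add_one.neg_pow, one_div, inv_pow, pow_succ]
      generalize 2 * (m : ℂ) + 1 = c
      ring
    have hsum : HasSum (fun k : ℕ => (∏ j ∈ Finset.range (2 * k + 2), (s + (j : ℂ))) *
        (x : ℂ) ^ (-s - 2 * k - 2) / (2 ^ (2 * k + 2) * (Nat.factorial (2 * k + 3) : ℂ)))
        ((∫ η in (-(1 / 2) : ℝ)..(1 / 2), ((x + η : ℝ) : ℂ) ^ (-s)) - (x : ℂ) ^ (-s)) := by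
      simp only [Function.comp_apply, heven, Finset.sum_range_one, mul_zero, Finset.range_zero,
        Finset.prod_empty, Nat.factorial_zero, pow_zero, Nat.cast_one, Nat.cast_zero, zero_add,
        div_one, one_mul, mul_one] at hall
      refine hall.congr_fun fun k => ?_
      have hpow : (x : ℂ) ^ (-s - 2 * k - 2) = (x : ℂ) ^ (-s) * ((x : ℂ) ^ (2 * k + 2))⁻¹ := by
        rw [show -s - 2 * (k : ℂ) - 2 = -s - ((2 * k + 2 : ℕ) : ℂ) by push_cast; ring,
          cpow_sub _ _ hxC, cpow_natCast, div_eq_mul_inv]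
      rw [hpow, (even_two_mul (k + 1)).neg_pow, inv_pow, Nat.factorial_succ (2 * k + 2),
        show 2 * (k + 1) = 2 * k + 2 by ring]
      push_cast
      rw [show (2 * (k : ℂ) + 2 + 1) = 2 * (k + 1) + 1 by ring]
      generalize 2 * ((k : ℂ) + 1) + 1 = c
      ring
    refine ⟨hsum.summable, ?_⟩
    rw [hsum.tsum_eq, intervalIntegral.integral_sub intervalIntegrable_const]
    · simp
      norm_num
    · refine ContinuousOn.intervalIntegrable fun t ht => ?_
      rw [Set.uIcc_of_le (by norm_num)] at ht
      refine ContinuousAt.continuousWithinAt ?_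
      have hmem : ((x + t : ℝ) : ℂ) ∈ slitPlane := ofReal_mem_slitPlane.2 (by linarith [ht.1])
      exact ContinuousAt.cpow (by fun_prop) continuousAt_const hmem
  · intro n hn
    have hodd : Odd n := by
      rw [← Nat.not_even_iff_odd]
      rintro ⟨m, rfl⟩
      exact hn ⟨m, by simp [two_mul]⟩
    rw [intervalIntegral.integral_ofReal_pow, ofReal_neg, (hodd.add_one).neg_pow, sub_self,
      zero_div, mul_zero]
end

section
/- (Combined exact formula (A4)/(A6)/(A8), Appendix) Let s be a complex number with Re(s) > 1 and let N ≥ 1 be a natural number. Then ζ(s) = Σ_{n=1}^{N} n^{−s} + (N+1/2)^{1−s}/(s−1) − Σ_{m=1}^{∞} Σ_{k=0}^{∞} [∏_{j=0}^{2k+1}(s+j)] · (N+m)^{−s−2k−2} / (2^{2k+2}·(2k+3)!), where the double series converges absolutely. -/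
open Complex MeasureTheory Finset

/-- The binomial series `(1 - u) ^ (-w) = ∑ w (w + 1) ⋯ (w + n - 1) uⁿ / n!` for `‖u‖ < 1`. -/
lemma hasSum_prod_add_div_factorial_mul_pow (w : ℂ) {u : ℂ} (hu : ‖u‖ < 1) :
    HasSum (fun n : ℕ => (∏ j ∈ Finset.range n, (w + (j : ℂ))) / (Nat.factorial n : ℂ) * u ^ n)
      ((1 - u) ^ (-w)) := by
  have h := (Complex.one_div_one_sub_cpow_hasFPowerSeriesOnBall_zero w).hasSum
    (y := u) (by simpa [enorm_eq_nnnorm, ← NNReal.coe_lt_coe] using hu)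
  rw [zero_add, one_div, ← cpow_neg] at h
  refine h.congr_fun fun n => ?_
  have hc : (Nat.factorial n : ℂ) * Ring.choose (w + n - 1) n =
      ∏ j ∈ Finset.range n, (w + (j : ℂ)) := by
    rw [← Ring.multichoose_eq, ← nsmul_eq_mul, Ring.factorial_nsmul_multichoose_eq_ascPochhammer,
      Polynomial.ascPochhammer_smeval_eq_eval]
    induction n with
    | zero => simp
    | succ n ih => rw [ascPochhammer_succ_eval, ih, Finset.prod_range_succ]
  have hn : (Nat.factorial n : ℂ) ≠ 0 := mod_cast n.factorial_ne_zero
  rw [← hc, mul_div_cancel_left₀ _ hn]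
  simp [mul_comm]

/-- The odd part of the binomial series. -/
lemma hasSum_odd_prod_add_div_factorial_mul_pow (w : ℂ) {u : ℂ} (hu : ‖u‖ < 1) :
    HasSum (fun k : ℕ => 2 * ((∏ j ∈ Finset.range (2 * k + 1), (w + (j : ℂ))) /
        (Nat.factorial (2 * k + 1) : ℂ) * u ^ (2 * k + 1)))
      ((1 - u) ^ (-w) - (1 + u) ^ (-w)) := by
  have h := (hasSum_prod_add_div_factorial_mul_pow w hu).sub
    (hasSum_prod_add_div_factorial_mul_pow w (u := -u) (by simpa using hu))
  rw [sub_neg_eq_add] at h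
  have hinj : Function.Injective fun k : ℕ => 2 * k + 1 := fun a b hab => by
    simp only at hab
    lia
  rw [← hinj.hasSum_iff] at h
  · refine h.congr_fun fun k => ?_
    simp only [Function.comp_apply, (odd_two_mul_add_one k).neg_pow]
    ring
  · intro n hn
    have he : Even n := by
      by_contra ho
      obtain ⟨k, rfl⟩ := Nat.not_even_iff_odd.mp ho
      exact hn ⟨k, rfl⟩
    simp [he.neg_pow]

/-- The expansion about its midpoint `n` of `∫ x ^ (-s)` over `[n - 1/2, n + 1/2]`. -/
lemma hasSum_midpoint_expansion {s : ℂ} (hs : s ≠ 1) {n : ℕ} (hn : 1 ≤ n) :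
    HasSum (fun k : ℕ => (∏ j ∈ Finset.range (2 * k + 2), (s + (j : ℂ))) *
        (n : ℂ) ^ (-s - 2 * k - 2) / (2 ^ (2 * k + 2) * (Nat.factorial (2 * k + 3) : ℂ)))
      ((((n : ℝ) - 1 / 2 : ℝ) : ℂ) ^ (1 - s) / (s - 1) -
        (((n : ℝ) + 1 / 2 : ℝ) : ℂ) ^ (1 - s) / (s - 1) - (n : ℂ) ^ (-s)) := by
  have hnR : (1 : ℝ) ≤ n := mod_cast hn
  have hn0 : (n : ℂ) ≠ 0 := mod_cast (by lia : n ≠ 0)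
  have hs' : s - 1 ≠ 0 := sub_ne_zero.mpr hs
  set v : ℝ := 1 / (2 * n) with hv
  have hv0 : 0 < v := by positivity
  have hv1 : v < 1 := by
    rw [hv, div_lt_one (by positivity)]
    linarith
  have hnv : (n : ℝ) * v = 1 / 2 := by
    rw [hv]
    field_simp
  have hvC : (v : ℂ) = (n : ℂ)⁻¹ * 2⁻¹ := by
    rw [hv]
    push_cast
    field_simp
  have h := ((hasSum_odd_prod_add_div_factorial_mul_pow (s - 1) (u := (v : ℂ))
    (by simpa [abs_of_pos hv0] using hv1)).mul_left ((n : ℂ) ^ (1 - s) / (s - 1)))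
  rw [← hasSum_nat_add_iff' 1] at h
  convert! h using 1
  · funext k
    have hp : (∏ j ∈ Finset.range (2 * (k + 1) + 1), (s - 1 + (j : ℂ))) =
        (∏ j ∈ Finset.range (2 * k + 2), (s + (j : ℂ))) * (s - 1) := by
      rw [show 2 * (k + 1) + 1 = 2 * k + 2 + 1 by ring, Finset.prod_range_succ']
      push_cast
      congr 1
      · exact Finset.prod_congr rfl fun j _ => by ring
      · ring
    have hpow : (n : ℂ) ^ (-s - 2 * k - 2) = (n : ℂ) ^ (1 - s) * (n : ℂ)⁻¹ ^ (2 * k + 3) := by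
      rw [inv_pow, ← div_eq_mul_inv, ← cpow_natCast, ← cpow_sub _ _ hn0]
      congr 1
      push_cast
      ring
    have hf : (Nat.factorial (2 * k + 3) : ℂ) ≠ 0 := mod_cast Nat.factorial_ne_zero _
    rw [hp, hpow, hvC, show 2 * (k + 1) + 1 = 2 * k + 3 by ring, mul_pow, inv_pow (2 : ℂ)]
    field_simp
    ring
  · have e1 : (((n : ℝ) - 1 / 2 : ℝ) : ℂ) ^ (1 - s) =
        (n : ℂ) ^ (1 - s) * (1 - (v : ℂ)) ^ (-(s - 1)) := by
      have := mul_cpow_ofReal_nonneg (a := n) (b := 1 - v) (by positivity) (by linarith) (1 - s)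
      rw [neg_sub, show (n : ℝ) - 1 / 2 = n * (1 - v) by rw [mul_sub, hnv, mul_one]]
      push_cast at this ⊢
      exact this
    have e2 : (((n : ℝ) + 1 / 2 : ℝ) : ℂ) ^ (1 - s) =
        (n : ℂ) ^ (1 - s) * (1 + (v : ℂ)) ^ (-(s - 1)) := by
      have := mul_cpow_ofReal_nonneg (a := n) (b := 1 + v) (by positivity) (by linarith) (1 - s)
      rw [neg_sub, show (n : ℝ) + 1 / 2 = n * (1 + v) by rw [mul_add, hnv, mul_one]]
      push_cast at this ⊢
      exact this
    have e3 : (n : ℂ) ^ (-s) = (n : ℂ) ^ (1 - s) * (n : ℂ)⁻¹ := by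
      rw [← div_eq_mul_inv, show -s = 1 - s - 1 by ring, cpow_sub _ _ hn0, cpow_one]
    rw [e1, e2, e3, Finset.sum_range_one, hvC]
    simp
    field_simp

/-- Absolute convergence of the double series. -/
lemma summable_norm_midpoint_expansion {s : ℂ} (hs : 1 < s.re) (N : ℕ) :
    Summable (fun p : ℕ × ℕ =>
      ‖(∏ j ∈ Finset.range (2 * p.2 + 2), (s + (j : ℂ))) *
          ((N + p.1 + 1 : ℕ) : ℂ) ^ (-s - 2 * p.2 - 2) /
          (2 ^ (2 * p.2 + 2) * (Nat.factorial (2 * p.2 + 3) : ℂ))‖) := by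
  have hnorm : 1 < ‖s‖ := hs.trans_le (re_le_norm s)
  have hB : Summable fun k : ℕ => (∏ j ∈ Finset.range (2 * k + 2), (‖s‖ + (j : ℝ))) /
      (2 ^ (2 * k + 2) * (Nat.factorial (2 * k + 3) : ℝ)) := by
    have h := (hasSum_midpoint_expansion (s := (‖s‖ : ℂ)) (mod_cast hnorm.ne') le_rfl).summable
    rw [← Complex.summable_ofReal]
    refine h.congr fun k => ?_
    push_cast
    simp
  have hA : Summable fun m : ℕ => ((N + m + 1 : ℕ) : ℝ) ^ (-s.re - 2) := by
    have h := Real.summable_nat_rpow (p := -s.re - 2) |>.mpr (by linarith)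
    refine ((summable_nat_add_iff (N + 1)).mpr h).congr fun m => ?_
    congr 2
    ring
  refine Summable.of_nonneg_of_le (fun _ => norm_nonneg _) (fun p => ?_)
    (hA.mul_of_nonneg hB (fun _ => by positivity) fun _ => by positivity)
  rw [norm_div, norm_mul, norm_mul, norm_pow, norm_natCast, Complex.norm_ofNat,
    norm_natCast_cpow_of_pos (by lia), norm_prod, ← mul_div_assoc]
  have hre : (-s - 2 * (p.2 : ℂ) - 2).re = -s.re - 2 * p.2 - 2 := by simp
  rw [hre, mul_comm]
  gcongr with j
  · exact mod_cast (by lia : 1 ≤ N + p.1 + 1)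
  · have : (0 : ℝ) ≤ p.2 := by positivity
    linarith
  · simpa using norm_add_le s (j : ℂ)

/-- (Combined exact formula (A4)/(A6)/(A8), Appendix) For `Re s > 1` and `N ≥ 1`,
`ζ(s) = Σ_{n=1}^{N} n^{-s} + (N+1/2)^{1-s}/(s-1)
        - Σ_{m=1}^{∞} Σ_{k=0}^{∞} (∏_{j=0}^{2k+1}(s+j)) (N+m)^{-s-2k-2}/(2^{2k+2}(2k+3)!)`,
where the double series converges absolutely. -/
theorem euler_mclaurin_exact_formula (s : ℂ) (hs : 1 < s.re) (N : ℕ) (hN : 1 ≤ N) :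
    Summable (fun p : ℕ × ℕ =>
      ‖(∏ j ∈ Finset.range (2 * p.2 + 2), (s + (j : ℂ))) *
          ((N + p.1 + 1 : ℕ) : ℂ) ^ (-s - 2 * p.2 - 2) /
          (2 ^ (2 * p.2 + 2) * (Nat.factorial (2 * p.2 + 3) : ℂ))‖) ∧
    riemannZeta s =
      (∑ n ∈ Finset.Icc 1 N, (n : ℂ) ^ (-s)) +
        (((N : ℝ) + 1 / 2 : ℝ) : ℂ) ^ (1 - s) / (s - 1) -
        ∑' p : ℕ × ℕ,
          (∏ j ∈ Finset.range (2 * p.2 + 2), (s + (j : ℂ))) *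
            ((N + p.1 + 1 : ℕ) : ℂ) ^ (-s - 2 * p.2 - 2) /
            (2 ^ (2 * p.2 + 2) * (Nat.factorial (2 * p.2 + 3) : ℂ)) := by
  have hs1 : s ≠ 1 := by
    rintro rfl
    simp at hs
  have hnorm := summable_norm_midpoint_expansion hs N
  refine ⟨hnorm, ?_⟩
  set F : ℕ → ℂ := fun m => (((N : ℝ) + m + 1 / 2 : ℝ) : ℂ) ^ (1 - s) / (s - 1) with hF
  have hinner := hnorm.of_norm.hasSum.prod_fiberwise fun m =>
    hasSum_midpoint_expansion hs1 (n := N + m + 1) (by lia)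
  have hz : Summable fun n : ℕ => ((n + 1 : ℕ) : ℂ) ^ (-s) := by
    refine ((summable_nat_add_iff 1).mpr (Complex.summable_one_div_nat_cpow.mpr hs)).congr
      fun n => ?_
    rw [cpow_neg, one_div]
  have htail := ((summable_nat_add_iff N).mpr hz).hasSum
  have hF0 : Filter.Tendsto F Filter.atTop (nhds 0) := by
    rw [tendsto_zero_iff_norm_tendsto_zero]
    have hlim : Filter.Tendsto (fun m : ℕ => ((N : ℝ) + m + 1 / 2) ^ (-(s.re - 1)) / ‖s - 1‖)
        Filter.atTop (nhds 0) := by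
      rw [← zero_div ‖s - 1‖]
      refine ((tendsto_rpow_neg_atTop (by linarith : 0 < s.re - 1)).comp ?_).div_const _
      exact Filter.tendsto_atTop_add_const_right _ _
        (Filter.tendsto_atTop_add_const_left _ _ tendsto_natCast_atTop_atTop)
    refine hlim.congr fun m => ?_
    rw [hF, norm_div, norm_cpow_eq_rpow_re_of_pos (by positivity)]
    simp
  have htel : HasSum (fun m => F m - F (m + 1)) (F 0) := by
    have hsum : Summable fun m => F m - F (m + 1) := by
      refine (hinner.add htail).summable.congr fun m => ?_
      simp only [hF]
      rw [show m + N + 1 = N + m + 1 by ring, sub_add_cancel]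
      congr 4 <;> push_cast <;> ring
    convert! hsum.hasSum using 1
    refine tendsto_nhds_unique ?_ hsum.hasSum.tendsto_sum_nat
    simp_rw [Finset.sum_range_sub']
    simpa using hF0.const_sub (F 0)
  have hdouble := hinner.unique ((htel.sub htail).congr_fun fun m => by
    simp only [hF]
    rw [show m + N + 1 = N + m + 1 by ring]
    congr 4 <;> push_cast <;> ring)
  have hzeta : riemannZeta s = ∑' n : ℕ, ((n + 1 : ℕ) : ℂ) ^ (-s) := by
    rw [zeta_eq_tsum_one_div_nat_add_one_cpow hs]
    refine tsum_congr fun n => ?_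
    rw [cpow_neg, one_div, Nat.cast_add_one]
  have hfin : ∑ n ∈ Finset.Icc 1 N, (n : ℂ) ^ (-s) =
      ∑ n ∈ Finset.range N, ((n + 1 : ℕ) : ℂ) ^ (-s) := by
    rw [Finset.range_eq_Ico, Finset.sum_Ico_add' (fun n : ℕ => (n : ℂ) ^ (-s)) 0 N 1]
    rfl
  rw [hdouble, hzeta, hfin, ← hz.sum_add_tsum_nat_add N]
  simp only [hF, Nat.cast_zero, add_zero]
  ring
end

section
/- (Ratio limit of the Euler–McLaurin coefficients, Appendix) Define the real sequence (α_{2k+1})_{k≥0} by α₁ = 1/24 and, for k ≥ 1, α_{2k+1} = 1/(2^{2k+2}·(2k+3)!) − Σ_{j=1}^{k} α_{2(k−j)+1} / (2^{2j}·(2j+1)!). Then the ratio of consecutive coefficients tends to −1/(4π²): lim_{k→∞} α_{2k+1}/α_{2k−1} = −1/(4π²). Consequently, for any fixed real x₀ > 0 the coefficients β_{2k+1} = α_{2k+1}·x₀^{−(2k+1)} satisfy lim_{k→∞} β_{2k+1}/β_{2k−1} = −1/(4π²·x₀²). -/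
open Filter Finset Real

/-- The coefficient `Bₙ(1/2) / n!` of the power series `X / (exp (X/2) - exp (-X/2))`. -/
noncomputable def bernoulliHalfCoeff (n : ℕ) : ℝ :=
  Polynomial.aeval (2⁻¹ : ℝ) ((1 / n.factorial : ℚ) • Polynomial.bernoulli n)

theorem bernoulliHalfCoeff_eq (n : ℕ) :
    bernoulliHalfCoeff n = (2 / 2 ^ n - 1) * bernoulli n / n.factorial := by
  have h := bernoulliFun_eval_half n
  rw [bernoulliFun, Polynomial.eval_map_algebraMap] at h
  rw [bernoulliHalfCoeff, map_smul, h, Rat.smul_def]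
  push_cast
  ring

theorem bernoulliHalfCoeff_zero : bernoulliHalfCoeff 0 = 1 := by
  norm_num [bernoulliHalfCoeff_eq]

open PowerSeries in
theorem mk_bernoulliHalfCoeff_mul_exp_sub_exp :
    PowerSeries.mk bernoulliHalfCoeff *
      (rescale (2⁻¹ : ℝ) (exp ℝ) - rescale (-2⁻¹ : ℝ) (exp ℝ)) = PowerSeries.X := by
  have hgen : PowerSeries.mk bernoulliHalfCoeff * (exp ℝ - 1) =
      PowerSeries.X * rescale (2⁻¹ : ℝ) (exp ℝ) :=
    Polynomial.bernoulli_generating_function (2⁻¹ : ℝ)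
  have hinv : rescale (2⁻¹ : ℝ) (exp ℝ) * rescale (-2⁻¹ : ℝ) (exp ℝ) = 1 := by
    rw [exp_mul_exp_eq_exp_add]
    simp
  have hsq : rescale (2⁻¹ : ℝ) (exp ℝ) * rescale (2⁻¹ : ℝ) (exp ℝ) = exp ℝ := by
    rw [exp_mul_exp_eq_exp_add, show (2⁻¹ + 2⁻¹ : ℝ) = 1 by norm_num]
    simp
  linear_combination rescale (-2⁻¹ : ℝ) (exp ℝ) * hgen +
    (PowerSeries.X - PowerSeries.mk bernoulliHalfCoeff * rescale (2⁻¹ : ℝ) (exp ℝ)) * hinv +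
    PowerSeries.mk bernoulliHalfCoeff * rescale (-2⁻¹ : ℝ) (exp ℝ) * hsq

theorem sum_range_two_mul {M : Type*} [AddCommMonoid M] (f : ℕ → M) (n : ℕ) :
    ∑ i ∈ range (2 * n), f i = ∑ i ∈ range n, (f (2 * i) + f (2 * i + 1)) := by
  induction n with
  | zero => simp
  | succ n ih => rw [sum_range_succ, ← ih, mul_add_one, sum_range_succ, sum_range_succ, add_assoc]

theorem sum_bernoulliHalfCoeff_div (m : ℕ) (hm : m ≠ 0) :
    ∑ j ∈ range (m + 1),
      bernoulliHalfCoeff (2 * (m - j)) / (2 ^ (2 * j) * ((2 * j + 1).factorial : ℝ)) = 0 := by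
  have h := congrArg (PowerSeries.coeff (2 * m + 1)) mk_bernoulliHalfCoeff_mul_exp_sub_exp
  rw [mul_comm (PowerSeries.mk _), PowerSeries.coeff_mul, Nat.sum_antidiagonal_eq_sum_range_succ_mk,
    PowerSeries.coeff_X, if_neg (by omega), show (2 * m + 1).succ = 2 * (m + 1) by omega,
    sum_range_two_mul] at h
  rw [← h]
  refine sum_congr rfl fun j hj => ?_
  have hj' : j ≤ m := by simpa [Nat.lt_succ_iff] using hj
  have hsub : 2 * m + 1 - (2 * j + 1) = 2 * (m - j) := by omega
  simp only [map_sub, PowerSeries.coeff_rescale, PowerSeries.coeff_exp, PowerSeries.coeff_mk, hsub,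
    (even_two_mul j).neg_pow, (odd_two_mul_add_one j).neg_pow]
  simp only [inv_pow, pow_succ, map_div₀, map_one, map_natCast]
  field_simp
  ring

theorem bernoulliHalfCoeff_recurrence (k : ℕ) :
    -bernoulliHalfCoeff (2 * (k + 1)) =
      1 / (2 ^ (2 * k + 2) * (Nat.factorial (2 * k + 3) : ℝ)) -
        ∑ j ∈ Finset.Icc 1 k,
          -bernoulliHalfCoeff (2 * (k - j + 1)) /
            (2 ^ (2 * j) * (Nat.factorial (2 * j + 1) : ℝ)) := by
  have h := sum_bernoulliHalfCoeff_div (k + 1) k.succ_ne_zero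
  rw [sum_range_succ, range_eq_Ico, sum_eq_sum_Ico_succ_bot (Nat.add_one_pos k), zero_add,
    Ico_add_one_right_eq_Icc] at h
  have hsum : ∑ j ∈ Finset.Icc 1 k,
      bernoulliHalfCoeff (2 * (k + 1 - j)) / (2 ^ (2 * j) * (Nat.factorial (2 * j + 1) : ℝ)) =
      ∑ j ∈ Finset.Icc 1 k,
        bernoulliHalfCoeff (2 * (k - j + 1)) / (2 ^ (2 * j) * (Nat.factorial (2 * j + 1) : ℝ)) :=
    sum_congr rfl fun j hj => by rw [Nat.sub_add_comm (mem_Icc.1 hj).2]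
  rw [hsum] at h
  simp only [Nat.sub_self, mul_zero, bernoulliHalfCoeff_zero, Nat.sub_zero, pow_zero, zero_add,
    Nat.factorial_one, Nat.cast_one, mul_one, div_one, show 2 * (k + 1) + 1 = 2 * k + 3 by ring,
    show 2 ^ (2 * (k + 1)) = (2 ^ (2 * k + 2) : ℝ) by ring] at h
  simp only [neg_div, sum_neg_distrib]
  linarith

theorem tendsto_tsum_one_div_nat_pow :
    Tendsto (fun k : ℕ => ∑' n : ℕ, 1 / (n : ℝ) ^ (2 * (k + 1))) atTop (nhds 1) := by
  have key : Tendsto (fun k : ℕ => ∑' n : ℕ, 1 / (n : ℝ) ^ (2 * (k + 1))) atTop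
      (nhds (∑' n : ℕ, if n = 1 then (1 : ℝ) else 0)) := by
    refine tendsto_tsum_of_dominated_convergence (bound := fun n : ℕ => 1 / (n : ℝ) ^ 2)
      (Real.summable_one_div_nat_pow.2 one_lt_two) (fun n => ?_) (Eventually.of_forall fun k n => ?_)
    · rcases Nat.lt_trichotomy n 1 with hn | rfl | hn
      · obtain rfl : n = 0 := by omega
        simp
      · simp
      · rw [if_neg hn.ne']
        have hn' : (1 : ℝ) < n := by exact_mod_cast hn
        have hlt : (1 / (n : ℝ)) < 1 := (div_lt_one (by positivity)).2 hn'
        have hpow := (tendsto_pow_atTop_nhds_zero_of_lt_one (by positivity) hlt).comp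
          (tendsto_atTop_mono (fun k : ℕ => (by omega : k ≤ 2 * (k + 1))) tendsto_id)
        simpa [Function.comp_def] using hpow
    · rcases Nat.eq_zero_or_pos n with rfl | hn
      · simp
      · have hn' : (1 : ℝ) ≤ n := by exact_mod_cast hn
        rw [Real.norm_of_nonneg (by positivity)]
        exact one_div_le_one_div_of_le (by positivity) (pow_le_pow_right₀ hn' (by omega))
  simpa using key

theorem tendsto_bernoulliHalfCoeff_mul :
    Tendsto (fun k : ℕ => bernoulliHalfCoeff (2 * (k + 1)) * (-4 * π ^ 2) ^ (k + 1)) atTop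
      (nhds 2) := by
  have hpow : Tendsto (fun k : ℕ => (2 : ℝ) / 2 ^ (2 * (k + 1))) atTop (nhds 0) :=
    ((tendsto_pow_atTop_atTop_of_one_lt (one_lt_two : (1 : ℝ) < 2)).comp
      (tendsto_atTop_mono (fun k : ℕ => (by omega : k ≤ 2 * (k + 1))) tendsto_id)).const_div_atTop 2
  have h := ((hpow.const_sub 1).mul tendsto_tsum_one_div_nat_pow).const_mul 2
  norm_num only at h
  refine h.congr fun k => ?_
  have hz := (hasSum_zeta_nat k.succ_ne_zero).tsum_eq
  rw [Nat.succ_eq_add_one] at hz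
  rw [hz, bernoulliHalfCoeff_eq, show 2 * (k + 1) - 1 = 2 * k + 1 by omega,
    show (-4 * π ^ 2 : ℝ) = (-1) * (2 ^ 2) * π ^ 2 by ring, mul_pow, mul_pow, ← pow_mul, ← pow_mul]
  ring

/-- (Ratio limit of the Euler–McLaurin coefficients, Appendix) If `α k` denotes
the coefficient `α_{2k+1}`, with `α₁ = 1/24` and
`α_{2k+1} = 1/(2^{2k+2}(2k+3)!) - Σ_{j=1}^{k} α_{2(k-j)+1}/(2^{2j}(2j+1)!)`,
then `α_{2k+1}/α_{2k-1} → -1/(4π²)`, and for any fixed `x₀ > 0` the coefficients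
`β_{2k+1} = α_{2k+1} x₀^{-(2k+1)}` satisfy `β_{2k+1}/β_{2k-1} → -1/(4π² x₀²)`. -/
theorem alpha_ratio_limit (α : ℕ → ℝ)
    (h0 : α 0 = 1 / 24)
    (hrec : ∀ k : ℕ, 1 ≤ k →
      α k = 1 / (2 ^ (2 * k + 2) * (Nat.factorial (2 * k + 3) : ℝ)) -
        ∑ j ∈ Finset.Icc 1 k,
          α (k - j) / (2 ^ (2 * j) * (Nat.factorial (2 * j + 1) : ℝ))) :
    Tendsto (fun k : ℕ => α (k + 1) / α k) atTop (nhds (-1 / (4 * π ^ 2))) ∧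
    ∀ x₀ : ℝ, 0 < x₀ →
      Tendsto
        (fun k : ℕ =>
          (α (k + 1) * x₀ ^ (-(2 * (k + 1 : ℤ) + 1))) /
            (α k * x₀ ^ (-(2 * (k : ℤ) + 1))))
        atTop (nhds (-1 / (4 * π ^ 2 * x₀ ^ 2))) := by
  have hα : ∀ k, α k = -bernoulliHalfCoeff (2 * (k + 1)) := by
    intro k
    induction k using Nat.strong_induction_on with
    | _ k ih =>
      rw [bernoulliHalfCoeff_recurrence]
      rcases Nat.eq_zero_or_pos k with rfl | hk
      · norm_num [h0, Nat.factorial]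
      · rw [hrec k hk]
        congr 1
        refine sum_congr rfl fun j hj => ?_
        rw [ih (k - j) (by have := mem_Icc.1 hj; omega)]
  have hratio : Tendsto (fun k : ℕ => α (k + 1) / α k) atTop (nhds (-1 / (4 * π ^ 2))) := by
    have h := (((tendsto_add_atTop_iff_nat 1).2 tendsto_bernoulliHalfCoeff_mul).div
      tendsto_bernoulliHalfCoeff_mul two_ne_zero).mul_const (-1 / (4 * π ^ 2))
    rw [div_self two_ne_zero, one_mul] at h
    refine h.congr fun k => ?_
    simp only [Pi.div_apply, hα, neg_div_neg_eq]
    have hπ : (-4 * π ^ 2 : ℝ) ≠ 0 := mul_ne_zero (by norm_num) (pow_ne_zero 2 pi_ne_zero)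
    rw [pow_succ _ (k + 1), ← mul_assoc, mul_div_right_comm,
      mul_div_mul_right _ _ (pow_ne_zero (k + 1) hπ)]
    field_simp
  refine ⟨hratio, fun x₀ hx₀ => ?_⟩
  have h := hratio.mul_const (1 / x₀ ^ 2)
  rw [div_mul_div_comm, mul_one] at h
  refine h.congr fun k => ?_
  rw [mul_div_mul_comm, ← zpow_sub₀ hx₀.ne',
    show -(2 * (k + 1 : ℤ) + 1) - -(2 * (k : ℤ) + 1) = -(2 : ℕ) by push_cast; ring, zpow_neg,
    zpow_natCast, one_div]
end
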